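/- Let N ≥ 1, 0 < α < N, and let γ, δ be real numbers with γ < N/q, δ < N(p-1)/p, γ + δ ≥ 0, and α/N = 1/p - 1/q + (γ+δ)/N for exponents 1 < p ≤ q < ∞. Then the fractional integral operator I_α f(x) = ∫_{ℝ^N} f(y) |x-y|^{α-N} dy satisfies the weighted norm inequality ‖|x|^{-γ} I_α f‖_{L^q(ℝ^N)} ≤ C ‖f(x)|x|^{δ}‖_{L^p(ℝ^N)} for all nonnegative measurable f, with constant C depending only on p, q, α, γ, δ, N. -/

import Mathlib

open MeasureTheory ENNReal

section Powers

theorem ofReal_rpow_mul_ofReal_rpow {t : ℝ} (ht : 0 < t) (a b : ℝ) :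
    ENNReal.ofReal (t ^ a) * ENNReal.ofReal (t ^ b) = ENNReal.ofReal (t ^ (a + b)) := by
  rw [← ENNReal.ofReal_mul (by positivity), Real.rpow_add ht]

theorem ofReal_rpow_rpow {t : ℝ} (ht : 0 < t) (a b : ℝ) :
    ENNReal.ofReal (t ^ a) ^ b = ENNReal.ofReal (t ^ (a * b)) := by
  rw [ENNReal.ofReal_rpow_of_pos (by positivity), ← Real.rpow_mul ht.le]

theorem ofReal_rpow_le_of_le_mul {s t c : ℝ} (hs : 0 < s) (ht : 0 < t) (hst : t ≤ c * s)
    (hts : s ≤ c * t) (a : ℝ) :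
    ENNReal.ofReal (t ^ a) ≤ ENNReal.ofReal (c ^ |a|) * ENNReal.ofReal (s ^ a) := by
  have hc : 0 < c := by
    by_contra! h
    nlinarith
  rw [← ENNReal.ofReal_mul (by positivity)]
  refine ENNReal.ofReal_le_ofReal ?_
  rcases le_total 0 a with ha | ha
  · rw [abs_of_nonneg ha, ← Real.mul_rpow hc.le hs.le]
    exact Real.rpow_le_rpow ht.le hst ha
  · rw [abs_of_nonpos ha, Real.rpow_neg hc.le, ← Real.inv_rpow hc.le,
      ← Real.mul_rpow (by positivity) hs.le]
    refine Real.rpow_le_rpow_of_nonpos (by positivity) ?_ ha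
    rwa [inv_mul_le_iff₀ hc]

theorem setLIntegral_Ioo_rpow {s R : ℝ} (hs : 0 < s) (hR : 0 ≤ R) :
    ∫⁻ t in Set.Ioo 0 R, ENNReal.ofReal (t ^ (s - 1)) = ENNReal.ofReal (1 / s * R ^ s) := by
  have hint : IntegrableOn (fun t : ℝ => t ^ (s - 1)) (Set.Ioc 0 R) :=
    (intervalIntegrable_iff_integrableOn_Ioc_of_le hR).1
      (intervalIntegral.intervalIntegrable_rpow' (by linarith))
  rw [← setLIntegral_congr (Ioo_ae_eq_Ioc (a := (0 : ℝ)) (b := R)).symm,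
    ← ofReal_integral_eq_lintegral_ofReal hint, ← intervalIntegral.integral_of_le hR,
    integral_rpow (Or.inl (by linarith))]
  · congr 1
    rw [sub_add_cancel, Real.zero_rpow hs.ne']
    ring
  · exact (ae_restrict_iff' measurableSet_Ioc).2 (.of_forall fun t ht => Real.rpow_nonneg ht.1.le _)

theorem setLIntegral_Ioi_rpow {s R : ℝ} (hs : 0 < s) (hR : 0 < R) :
    ∫⁻ t in Set.Ioi R, ENNReal.ofReal (t ^ (-s - 1)) = ENNReal.ofReal (1 / s * R ^ (-s)) := by
  rw [← ofReal_integral_eq_lintegral_ofReal (integrableOn_Ioi_rpow_of_lt (by linarith) hR),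
    integral_Ioi_rpow_of_lt (by linarith) hR]
  · congr 1
    rw [sub_add_cancel]
    field_simp
  · exact (ae_restrict_iff' measurableSet_Ioi).2
      (.of_forall fun t ht => Real.rpow_nonneg (hR.trans ht).le _)

/-- Layer-cake formula for the power of a single extended nonnegative number. -/
theorem setLIntegral_Ioi_ite_rpow {s : ℝ} (hs : 0 < s) (u : ℝ≥0∞) :
    ∫⁻ t in Set.Ioi (0 : ℝ), (if ENNReal.ofReal t < u then ENNReal.ofReal (t ^ (s - 1)) else 0) =
      ENNReal.ofReal (1 / s) * u ^ s := by
  have key : ∀ R : ℝ, 0 ≤ R → ∫⁻ t in Set.Ioi (0 : ℝ),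
      (if ENNReal.ofReal t < ENNReal.ofReal R then ENNReal.ofReal (t ^ (s - 1)) else 0) =
      ENNReal.ofReal (1 / s) * ENNReal.ofReal R ^ s := by
    intro R hR
    rw [ENNReal.ofReal_rpow_of_nonneg hR hs.le, ← ENNReal.ofReal_mul (by positivity),
      ← setLIntegral_Ioo_rpow hs hR, ← lintegral_indicator measurableSet_Ioi,
      ← lintegral_indicator measurableSet_Ioo]
    refine lintegral_congr fun t => ?_
    by_cases ht : 0 < t
    · simp [Set.indicator, ht, ENNReal.ofReal_lt_ofReal_iff_of_nonneg ht.le]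
    · simp [Set.indicator, ht]
  rcases eq_or_ne u ⊤ with rfl | hu
  · rw [ENNReal.top_rpow_of_pos hs, ENNReal.mul_top (by simpa using hs)]
    refine ENNReal.eq_top_of_forall_nnreal_le fun r => ?_
    set R : ℝ := (s * r) ^ (1 / s) with hRdef
    have hR : 0 ≤ R := by positivity
    have : (r : ℝ≥0∞) = ENNReal.ofReal (1 / s) * ENNReal.ofReal R ^ s := by
      rw [ENNReal.ofReal_rpow_of_nonneg hR hs.le, ← ENNReal.ofReal_mul (by positivity), hRdef,
        ← Real.rpow_mul (by positivity), one_div_mul_cancel hs.ne', Real.rpow_one,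
        ← mul_assoc, one_div_mul_cancel hs.ne', one_mul, ENNReal.ofReal_coe_nnreal]
    rw [this, ← key R hR]
    refine lintegral_mono fun t => ?_
    dsimp only
    split_ifs <;> simp_all
  · have := key u.toReal ENNReal.toReal_nonneg
    rwa [ENNReal.ofReal_toReal hu] at this

end Powers

section Radial

open Module Metric

variable {E : Type*} [NormedAddCommGroup E] [NormedSpace ℝ E] [FiniteDimensional ℝ E]
  [Nontrivial E]

theorem ofReal_pow_finrank_sub_one_mul {t : ℝ} (ht : 0 < t) (a : ℝ) :
    ENNReal.ofReal (t ^ (finrank ℝ E - 1)) * ENNReal.ofReal (t ^ a) =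
      ENNReal.ofReal (t ^ (finrank ℝ E + a - 1)) := by
  rw [← Real.rpow_natCast, ofReal_rpow_mul_ofReal_rpow ht,
    Nat.cast_sub (Nat.one_le_iff_ne_zero.2 finrank_pos.ne')]
  congr 2
  push_cast
  ring

variable [MeasurableSpace E] [BorelSpace E] (μ : Measure E) [μ.IsAddHaarMeasure]

theorem lintegral_fun_norm_addHaar {f : ℝ → ℝ≥0∞} (hf : Measurable f) :
    ∫⁻ x, f ‖x‖ ∂μ = finrank ℝ E * μ (ball 0 1) *
      ∫⁻ r in Set.Ioi (0 : ℝ), ENNReal.ofReal (r ^ (finrank ℝ E - 1)) * f r :=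
  calc
    ∫⁻ x, f ‖x‖ ∂μ = ∫⁻ x : ({(0)}ᶜ : Set E), f ‖x.1‖ ∂(μ.comap (↑)) := by
      rw [lintegral_subtype_comap (measurableSet_singleton _).compl fun x ↦ f ‖x‖,
        restrict_compl_singleton]
    _ = ∫⁻ x, f x.2 ∂μ.toSphere.prod (.volumeIoiPow (finrank ℝ E - 1)) := by
      simpa using μ.measurePreserving_homeomorphUnitSphereProd.lintegral_comp
        (f := f ∘ Subtype.val ∘ Prod.snd)
        (hf.comp (measurable_subtype_coe.comp measurable_snd))
    _ = μ.toSphere Set.univ * ∫⁻ x : Set.Ioi (0 : ℝ), f x ∂.volumeIoiPow (finrank ℝ E - 1) := by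
      rw [lintegral_prod (fun x : sphere (0 : E) 1 × Set.Ioi (0 : ℝ) => f x.2)
        (hf.comp (measurable_subtype_coe.comp measurable_snd)).aemeasurable]
      simp [mul_comm]
    _ = _ := by
      rw [Measure.volumeIoiPow, lintegral_withDensity_eq_lintegral_mul _ (by fun_prop)
        (show Measurable fun x : Set.Ioi (0 : ℝ) => f x from hf.comp measurable_subtype_coe),
      μ.toSphere_apply_univ]
      congr 1
      exact lintegral_subtype_comap measurableSet_Ioi
        fun r => ENNReal.ofReal (r ^ (finrank ℝ E - 1)) * f r

/-- Integral of a power of the norm over a ball, uniformly in the radius. -/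
theorem exists_lintegral_norm_lt_rpow_le {a : ℝ} (ha : 0 < finrank ℝ E + a) :
    ∃ C : ℝ≥0∞, C ≠ ⊤ ∧ ∀ R : ℝ, 0 < R →
      ∫⁻ x, (if ‖x‖ < R then ENNReal.ofReal (‖x‖ ^ a) else 0) ∂μ ≤
        C * ENNReal.ofReal (R ^ (finrank ℝ E + a)) := by
  refine ⟨finrank ℝ E * μ (ball 0 1) * ENNReal.ofReal (1 / (finrank ℝ E + a)),
    by finiteness [(measure_ball_lt_top (μ := μ) (x := (0 : E)) (r := 1)).ne], fun R hR => ?_⟩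
  rw [lintegral_fun_norm_addHaar μ (f := fun r => if r < R then ENNReal.ofReal (r ^ a) else 0)
    (Measurable.ite measurableSet_Iio (by fun_prop) (by fun_prop)), mul_assoc _ (ENNReal.ofReal _),
    ← ENNReal.ofReal_mul (by positivity), ← setLIntegral_Ioo_rpow ha hR.le]
  refine mul_le_mul' le_rfl ?_
  rw [← lintegral_indicator measurableSet_Ioi, ← lintegral_indicator measurableSet_Ioo]
  refine lintegral_mono fun t => ?_
  by_cases ht : 0 < t
  · by_cases htR : t < R
    · simp [Set.indicator, ht, htR, ofReal_pow_finrank_sub_one_mul ht]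
    · simp [Set.indicator, ht, htR]
  · simp [Set.indicator, ht]

/-- Integral of a power of the norm over the complement of a ball, uniformly in the radius. -/
theorem exists_lintegral_le_norm_rpow_le {a : ℝ} (ha : finrank ℝ E + a < 0) :
    ∃ C : ℝ≥0∞, C ≠ ⊤ ∧ ∀ R : ℝ, 0 < R →
      ∫⁻ x, (if R ≤ ‖x‖ then ENNReal.ofReal (‖x‖ ^ a) else 0) ∂μ ≤
        C * ENNReal.ofReal (R ^ (finrank ℝ E + a)) := by
  have ha' : 0 < -(finrank ℝ E + a) := by linarith
  refine ⟨finrank ℝ E * μ (ball 0 1) * ENNReal.ofReal (1 / -(finrank ℝ E + a)),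
    by finiteness [(measure_ball_lt_top (μ := μ) (x := (0 : E)) (r := 1)).ne], fun R hR => ?_⟩
  have hI := setLIntegral_Ioi_rpow ha' hR
  rw [neg_neg] at hI
  rw [lintegral_fun_norm_addHaar μ (f := fun r => if R ≤ r then ENNReal.ofReal (r ^ a) else 0)
    (Measurable.ite measurableSet_Ici (by fun_prop) (by fun_prop)), mul_assoc _ (ENNReal.ofReal _),
    ← ENNReal.ofReal_mul (by positivity), ← hI]
  refine mul_le_mul' le_rfl ?_
  rw [← lintegral_indicator measurableSet_Ioi, setLIntegral_congr Ioi_ae_eq_Ici,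
    ← lintegral_indicator measurableSet_Ici]
  refine lintegral_mono fun t => ?_
  by_cases ht : 0 < t
  · by_cases htR : R ≤ t
    · simp [Set.indicator, ht, htR, ofReal_pow_finrank_sub_one_mul ht]
    · simp [Set.indicator, ht, htR]
  · simp [Set.indicator, ht]

end Radial

section Schur

variable {X Y : Type*} [MeasurableSpace X] [MeasurableSpace Y] {μ : Measure X} {ν : Measure Y}

theorem lintegral_mul_rpow_le_of_one_le {k G : Y → ℝ≥0∞} (hk : Measurable k) (hG : Measurable G)
    {r : ℝ} (hr : 1 ≤ r) :
    (∫⁻ y, k y * G y ∂ν) ^ r ≤ (∫⁻ y, k y ^ r * G y ∂ν) * (∫⁻ y, G y ∂ν) ^ (r - 1) := by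
  have hr0 : 0 < r := by linarith
  have h1 : 0 ≤ 1 - 1 / r := sub_nonneg.2 ((div_le_one hr0).2 hr)
  have h2 : ∀ y, k y * G y = (k y ^ r * G y) ^ (1 / r) * G y ^ (1 - 1 / r) := fun y => by
    rw [ENNReal.mul_rpow_of_nonneg _ _ (by positivity), ← ENNReal.rpow_mul,
      mul_one_div_cancel hr0.ne', ENNReal.rpow_one, mul_assoc,
      ← ENNReal.rpow_add_of_nonneg _ _ (by positivity) h1, add_sub_cancel, ENNReal.rpow_one]
  calc (∫⁻ y, k y * G y ∂ν) ^ r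
      ≤ ((∫⁻ y, k y ^ r * G y ∂ν) ^ (1 / r) * (∫⁻ y, G y ∂ν) ^ (1 - 1 / r)) ^ r := by
        simp_rw [h2]
        exact ENNReal.rpow_le_rpow (ENNReal.lintegral_mul_norm_pow_le (by fun_prop)
          hG.aemeasurable (by positivity) h1 (by ring)) hr0.le
    _ = _ := by
        rw [ENNReal.mul_rpow_of_nonneg _ _ hr0.le, ← ENNReal.rpow_mul, ← ENNReal.rpow_mul,
          one_div_mul_cancel hr0.ne', ENNReal.rpow_one, sub_mul, one_mul,
          one_div_mul_cancel hr0.ne']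

/-- An `L^p → L^q` **Schur test** for a factorized kernel `K₁ * K₂`. -/
theorem lintegral_kernel_rpow_le_of_schur [SFinite μ] [SFinite ν] {p p' q : ℝ}
    (hp : p.HolderConjugate p') (hpq : p ≤ q) {K₁ K₂ : X → Y → ℝ≥0∞}
    (hK₁ : Measurable (Function.uncurry K₁)) (hK₂ : Measurable (Function.uncurry K₂))
    {A : X → ℝ≥0∞} (hA : Measurable A) {B : ℝ≥0∞}
    (h₁ : ∀ᵐ x ∂μ, (∫⁻ y, K₁ x y ^ p' ∂ν) ^ (1 / p') ≤ A x)
    (h₂ : ∀ᵐ y ∂ν, ∫⁻ x, (A x * K₂ x y) ^ q ∂μ ≤ B)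
    {g : Y → ℝ≥0∞} (hg : Measurable g) :
    (∫⁻ x, (∫⁻ y, K₁ x y * K₂ x y * g y ∂ν) ^ q ∂μ) ^ (1 / q) ≤
      B ^ (1 / q) * (∫⁻ y, g y ^ p ∂ν) ^ (1 / p) := by
  have hp0 : 0 < p := hp.pos
  have hq0 : 0 < q := hp0.trans_le hpq
  have hr : 1 ≤ q / p := (one_le_div hp0).2 hpq
  have hK₁' : ∀ x, Measurable (K₁ x) := fun x => hK₁.of_uncurry_left
  have hK₂' : ∀ x, Measurable (K₂ x) := fun x => hK₂.of_uncurry_left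
  have hpt : ∀ᵐ x ∂μ, (∫⁻ y, K₁ x y * K₂ x y * g y ∂ν) ^ q ≤
      ∫⁻ y, (A x * K₂ x y) ^ q * g y ^ p * (∫⁻ y, g y ^ p ∂ν) ^ (q / p - 1) ∂ν := by
    filter_upwards [h₁] with x hx
    calc (∫⁻ y, K₁ x y * K₂ x y * g y ∂ν) ^ q
        ≤ (A x * (∫⁻ y, (K₂ x y * g y) ^ p ∂ν) ^ (1 / p)) ^ q := by
          refine ENNReal.rpow_le_rpow ?_ hq0.le
          simp_rw [mul_assoc]
          exact (ENNReal.lintegral_mul_le_Lp_mul_Lq ν hp.symm (hK₁' x).aemeasurable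
            ((hK₂' x).mul hg).aemeasurable).trans (mul_le_mul' hx le_rfl)
      _ = A x ^ q * (∫⁻ y, K₂ x y ^ p * g y ^ p ∂ν) ^ (q / p) := by
          rw [ENNReal.mul_rpow_of_nonneg _ _ hq0.le, ← ENNReal.rpow_mul, one_div_mul_eq_div]
          simp_rw [ENNReal.mul_rpow_of_nonneg _ _ hp0.le]
      _ ≤ A x ^ q * ((∫⁻ y, (K₂ x y ^ p) ^ (q / p) * g y ^ p ∂ν) *
            (∫⁻ y, g y ^ p ∂ν) ^ (q / p - 1)) :=
          mul_le_mul' le_rfl (lintegral_mul_rpow_le_of_one_le ((hK₂' x).pow_const _)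
            (hg.pow_const _) hr)
      _ = _ := by
          have := hK₂' x
          rw [lintegral_mul_const _ (by fun_prop), ← mul_assoc,
            ← lintegral_const_mul _ (by fun_prop)]
          simp_rw [← ENNReal.rpow_mul, mul_div_cancel₀ q hp0.ne',
            ENNReal.mul_rpow_of_nonneg _ _ hq0.le, mul_assoc]
  have hm : Measurable (Function.uncurry fun x y => (A x * K₂ x y) ^ q * g y ^ p) := by
    have : Measurable fun z : X × Y => K₂ z.1 z.2 := hK₂
    simp only [Function.uncurry_def]
    fun_prop
  have hm' : ∀ y, Measurable fun x => (A x * K₂ x y) ^ q := fun y => by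
    have : Measurable fun x => K₂ x y := hK₂.of_uncurry_right
    fun_prop
  have hmain : ∫⁻ x, (∫⁻ y, K₁ x y * K₂ x y * g y ∂ν) ^ q ∂μ ≤
      B * (∫⁻ y, g y ^ p ∂ν) ^ (q / p) := by
    calc ∫⁻ x, (∫⁻ y, K₁ x y * K₂ x y * g y ∂ν) ^ q ∂μ
        ≤ ∫⁻ x, ∫⁻ y, (A x * K₂ x y) ^ q * g y ^ p * (∫⁻ y, g y ^ p ∂ν) ^ (q / p - 1) ∂ν ∂μ :=
          lintegral_mono_ae hpt
      _ = ∫⁻ y, ∫⁻ x, (A x * K₂ x y) ^ q * g y ^ p * (∫⁻ y, g y ^ p ∂ν) ^ (q / p - 1) ∂μ ∂ν :=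
          lintegral_lintegral_swap (hm.mul_const _).aemeasurable
      _ ≤ ∫⁻ y, B * g y ^ p * (∫⁻ y, g y ^ p ∂ν) ^ (q / p - 1) ∂ν := by
          refine lintegral_mono_ae ?_
          filter_upwards [h₂] with y hy
          have := hm' y
          rw [lintegral_mul_const _ (by fun_prop), lintegral_mul_const _ (by fun_prop)]
          gcongr
      _ = _ := by
          rw [lintegral_mul_const _ (by fun_prop), lintegral_const_mul _ (by fun_prop), mul_assoc]
          congr 1
          conv_lhs => enter [1]; rw [← ENNReal.rpow_one (∫⁻ y, g y ^ p ∂ν)]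
          rw [← ENNReal.rpow_add_of_nonneg _ _ zero_le_one (by linarith), add_sub_cancel]
  calc _ ≤ (B * (∫⁻ y, g y ^ p ∂ν) ^ (q / p)) ^ (1 / q) :=
        ENNReal.rpow_le_rpow hmain (by positivity)
    _ = _ := by
        rw [ENNReal.mul_rpow_of_nonneg _ _ (by positivity), ← ENNReal.rpow_mul]
        congr 2
        field_simp

end Schur

section HardyLittlewoodSobolev

open Module

variable {E : Type*} [NormedAddCommGroup E] [NormedSpace ℝ E] [FiniteDimensional ℝ E]
  [Nontrivial E] [MeasurableSpace E] [BorelSpace E] (μ : Measure E) [μ.IsAddHaarMeasure]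

/-- Truncating the kernel at radius `t ^ (-q / d)` and the function at height `t ^ (q / p)`
leaves a remainder of size `t` in the fractional integral. -/
theorem exists_fractionalIntegral_le_add_truncated {p q β : ℝ} (hp : 1 < p) (hpq : p < q)
    (hβ : β = finrank ℝ E * (1 / p - 1 / q)) :
    ∃ M : ℝ≥0∞, M ≠ ⊤ ∧ ∀ g : E → ℝ≥0∞, Measurable g → ∫⁻ y, g y ^ p ∂μ = 1 →
      ∀ (x : E) (t : ℝ), 0 < t →
        ∫⁻ y, g y * ENNReal.ofReal (‖x - y‖ ^ (β - finrank ℝ E)) ∂μ ≤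
          M * ENNReal.ofReal t +
          ∫⁻ y, (if ENNReal.ofReal t < g y ^ (p / q) then g y else 0) *
            (if ‖x - y‖ < t ^ (-q / finrank ℝ E) then
              ENNReal.ofReal (‖x - y‖ ^ (β - finrank ℝ E)) else 0) ∂μ := by
  have hd : (0 : ℝ) < finrank ℝ E := by exact_mod_cast finrank_pos
  set d : ℝ := (finrank ℝ E : ℝ) with hd_def
  have hp0 : 0 < p := by linarith
  have hq0 : 0 < q := by linarith
  have hpc : p.HolderConjugate (p / (p - 1)) := Real.HolderConjugate.conjExponent hp
  set p' := p / (p - 1) with hp'_def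
  have hp'0 : 0 < p' := hpc.symm.pos
  have hinv : 1 / p' = 1 - 1 / p := by
    have := hpc.inv_add_inv_eq_one
    simp only [one_div]
    linarith
  have hβ0 : 0 < β := by
    rw [hβ]
    exact mul_pos hd (sub_pos.2 (one_div_lt_one_div_of_lt hp0 hpq))
  have hfar : d + (β - d) * p' = p' * (-d / q) := by
    have : d + (β - d) * p' = p' * (d * (1 / p') + β - d) := by
      field_simp
      ring
    rw [this, hinv, hβ]
    ring
  obtain ⟨C₁, hC₁, h₁⟩ := exists_lintegral_le_norm_rpow_le μ (a := (β - d) * p')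
    (by
      rw [← hd_def, hfar]
      exact mul_neg_of_pos_of_neg hp'0 (div_neg_of_neg_of_pos (by linarith) hq0))
  obtain ⟨C₂, hC₂, h₂⟩ := exists_lintegral_norm_lt_rpow_le μ (a := β - d)
    (by rw [← hd_def]; linarith)
  refine ⟨C₁ ^ (1 / p') + C₂, by finiteness, fun g hg hg1 x t ht => ?_⟩
  set R := t ^ (-q / d) with hR_def
  have hR : 0 < R := by positivity
  have hk : ∀ a : ℝ, Measurable fun y : E => ENNReal.ofReal (‖x - y‖ ^ a) := by fun_prop
  have hsn : MeasurableSet {y : E | ‖x - y‖ < R} :=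
    measurableSet_lt (by fun_prop) (by fun_prop)
  have hsf : MeasurableSet {y : E | R ≤ ‖x - y‖} :=
    measurableSet_le (by fun_prop) (by fun_prop)
  have hshi : MeasurableSet {y : E | ENNReal.ofReal t < g y ^ (p / q)} :=
    measurableSet_lt (by fun_prop) (by fun_prop)
  set kn : E → ℝ≥0∞ := fun y =>
    if ‖x - y‖ < R then ENNReal.ofReal (‖x - y‖ ^ (β - d)) else 0 with hkn_def
  set kf : E → ℝ≥0∞ := fun y =>
    if R ≤ ‖x - y‖ then ENNReal.ofReal (‖x - y‖ ^ (β - d)) else 0 with hkf_def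
  have hkn : Measurable kn := Measurable.ite hsn (hk _) measurable_const
  have hkf : Measurable kf := Measurable.ite hsf (hk _) measurable_const
  have hlow : ∫⁻ y, ENNReal.ofReal (t ^ (q / p)) * kn y ∂μ ≤ C₂ * ENNReal.ofReal t := by
    rw [lintegral_const_mul _ hkn,
      lintegral_sub_left_eq_self (μ := μ)
        (fun z : E => if ‖z‖ < R then ENNReal.ofReal (‖z‖ ^ (β - d)) else 0) x]
    refine (mul_le_mul' le_rfl (h₂ R hR)).trans_eq ?_
    rw [mul_left_comm, hR_def, ← Real.rpow_mul ht.le, ofReal_rpow_mul_ofReal_rpow ht]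
    congr 2
    rw [← hd_def, hβ]
    convert Real.rpow_one t using 2
    field_simp
    ring
  have hfarle : ∫⁻ y, g y * kf y ∂μ ≤ C₁ ^ (1 / p') * ENNReal.ofReal t := by
    refine (ENNReal.lintegral_mul_le_Lp_mul_Lq μ hpc hg.aemeasurable hkf.aemeasurable).trans ?_
    rw [hg1, ENNReal.one_rpow, one_mul]
    have hpw : ∀ y, kf y ^ p' = if R ≤ ‖x - y‖ then
        ENNReal.ofReal (‖x - y‖ ^ ((β - d) * p')) else 0 := fun y => by
      simp only [hkf_def]
      split_ifs with h
      · exact ofReal_rpow_rpow (hR.trans_le h) _ _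
      · exact ENNReal.zero_rpow_of_pos hp'0
    simp_rw [hpw]
    rw [lintegral_sub_left_eq_self (μ := μ)
        (fun z : E => if R ≤ ‖z‖ then ENNReal.ofReal (‖z‖ ^ ((β - d) * p')) else 0) x]
    refine (ENNReal.rpow_le_rpow (h₁ R hR) (by positivity)).trans_eq ?_
    rw [ENNReal.mul_rpow_of_nonneg _ _ (by positivity), ofReal_rpow_rpow hR, ← hd_def, hfar,
      hR_def, ← Real.rpow_mul ht.le]
    congr 2
    convert Real.rpow_one t using 2
    field_simp
  calc ∫⁻ y, g y * ENNReal.ofReal (‖x - y‖ ^ (β - d)) ∂μ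
      ≤ ∫⁻ y, (g y * kf y + ENNReal.ofReal (t ^ (q / p)) * kn y +
          (if ENNReal.ofReal t < g y ^ (p / q) then g y else 0) * kn y) ∂μ := by
        refine lintegral_mono fun y => ?_
        simp only [hkf_def, hkn_def]
        rcases le_or_gt R ‖x - y‖ with h | h
        · simp [h, h.not_gt]
        · by_cases hy : ENNReal.ofReal t < g y ^ (p / q)
          · simp [h, h.not_ge, hy]
          · have hgy : g y ≤ ENNReal.ofReal (t ^ (q / p)) := by
              have := ENNReal.rpow_le_rpow (not_lt.1 hy) (show 0 ≤ q / p by positivity)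
              rwa [← ENNReal.rpow_mul, div_mul_div_cancel₀ hq0.ne', div_self hp0.ne',
                ENNReal.rpow_one, ENNReal.ofReal_rpow_of_pos ht] at this
            simp only [h, h.not_ge, hy, if_true, if_false, mul_zero, zero_mul, zero_add, add_zero]
            gcongr
    _ = _ := by
        rw [lintegral_add_left (by fun_prop), lintegral_add_left (by fun_prop)]
    _ ≤ _ := by
        rw [add_mul]
        gcongr

/-- **Hardy–Littlewood–Sobolev inequality** for normalized functions. -/
theorem exists_lintegral_fractionalIntegral_rpow_le_of_lintegral_eq_one {p q β : ℝ} (hp : 1 < p)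
    (hpq : p < q) (hβ : β = finrank ℝ E * (1 / p - 1 / q)) :
    ∃ C : ℝ≥0∞, C ≠ ⊤ ∧ ∀ g : E → ℝ≥0∞, Measurable g → ∫⁻ y, g y ^ p ∂μ = 1 →
      ∫⁻ x, (∫⁻ y, g y * ENNReal.ofReal (‖x - y‖ ^ (β - finrank ℝ E)) ∂μ) ^ q ∂μ ≤ C := by
  obtain ⟨M₀, hM₀, hM⟩ := exists_fractionalIntegral_le_add_truncated μ hp hpq hβ
  have hd : (0 : ℝ) < finrank ℝ E := by exact_mod_cast finrank_pos
  set d : ℝ := (finrank ℝ E : ℝ) with hd_def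
  have hp0 : 0 < p := by linarith
  have hq0 : 0 < q := by linarith
  have hβ0 : 0 < β := by
    rw [hβ]
    exact mul_pos hd (sub_pos.2 (one_div_lt_one_div_of_lt hp0 hpq))
  obtain ⟨C₂, hC₂, h₂⟩ := exists_lintegral_norm_lt_rpow_le μ (a := β - d)
    (by rw [← hd_def]; linarith)
  set M : ℝ≥0∞ := M₀ + 1 with hM_def
  have hMtop : M ≠ ⊤ := by finiteness
  have hM0 : M ≠ 0 := by simp [hM_def]
  set s : ℝ := q - q / p with hs_def
  have hs : 0 < s := sub_pos.2 (div_lt_self hq0 hp)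
  refine ⟨M ^ q * (ENNReal.ofReal q * (C₂ * ENNReal.ofReal (1 / s))), by finiteness,
    fun g hg hg1 => ?_⟩
  set T : E → ℝ≥0∞ := fun x => ∫⁻ y, g y * ENNReal.ofReal (‖x - y‖ ^ (β - d)) ∂μ with hT_def
  set G : ℝ → E → ℝ≥0∞ := fun t y => if ENNReal.ofReal t < g y ^ (p / q) then g y else 0
    with hG_def
  set k : ℝ → E → ℝ≥0∞ := fun t z =>
    if ‖z‖ < t ^ (-q / d) then ENNReal.ofReal (‖z‖ ^ (β - d)) else 0 with hk_def
  have hG : Measurable fun z : ℝ × E => G z.1 z.2 :=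
    Measurable.ite (measurableSet_lt (by fun_prop) (by fun_prop)) (by fun_prop) measurable_const
  have hk : Measurable fun z : ℝ × E => k z.1 z.2 :=
    Measurable.ite (measurableSet_lt (by fun_prop) (by fun_prop)) (by fun_prop) measurable_const
  have hGk : Measurable fun z : (ℝ × E) × E => G z.1.1 z.2 * k z.1.1 (z.1.2 - z.2) :=
    (hG.comp (g := fun z : ℝ × E => G z.1 z.2) (f := fun z : (ℝ × E) × E => (z.1.1, z.2))
      (by fun_prop)).mul
    (hk.comp (g := fun z : ℝ × E => k z.1 z.2) (f := fun z : (ℝ × E) × E => (z.1.1, z.1.2 - z.2))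
      (by fun_prop))
  have hH : Measurable fun z : ℝ × E => ∫⁻ y, G z.1 y * k z.1 (z.2 - y) ∂μ :=
    hGk.lintegral_prod_right'
  have hlevel : ∀ x, ∀ t : ℝ, 0 < t → ENNReal.ofReal t < M⁻¹ * T x →
      ENNReal.ofReal t ≤ ∫⁻ y, G t y * k t (x - y) ∂μ := by
    intro x t ht hlt
    by_contra! hcon
    refine hlt.not_ge ?_
    rw [ENNReal.inv_mul_le_iff hM0 hMtop, hM_def, add_mul, one_mul]
    exact (hM g hg hg1 x t ht).trans (by gcongr)
  have hpt : ∀ x, ENNReal.ofReal (1 / q) * (M⁻¹ * T x) ^ q ≤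
      ∫⁻ t in Set.Ioi (0 : ℝ), ENNReal.ofReal (t ^ (q - 2)) *
        ∫⁻ y, G t y * k t (x - y) ∂μ := by
    intro x
    rw [← setLIntegral_Ioi_ite_rpow hq0]
    refine setLIntegral_mono' measurableSet_Ioi fun t (ht : 0 < t) => ?_
    split_ifs with h
    · calc ENNReal.ofReal (t ^ (q - 1)) = ENNReal.ofReal (t ^ (q - 2)) * ENNReal.ofReal t := by
            conv_rhs => rw [← Real.rpow_one t, ← Real.rpow_mul ht.le, one_mul,
              ofReal_rpow_mul_ofReal_rpow ht]
            congr 2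
            ring
        _ ≤ _ := by
            gcongr
            exact hlevel x t ht h
    · exact zero_le
  have hk_int : ∀ t : ℝ, 0 < t → ∀ y, ∫⁻ x, k t (x - y) ∂μ ≤
      C₂ * ENNReal.ofReal (t ^ (-q / d * β)) := by
    intro t ht y
    rw [lintegral_sub_right_eq_self (μ := μ) (k t) y]
    refine (h₂ (t ^ (-q / d)) (by positivity)).trans_eq ?_
    rw [← Real.rpow_mul ht.le, ← hd_def, add_sub_cancel]
  have hmain : ∫⁻ x, ENNReal.ofReal (1 / q) * (M⁻¹ * T x) ^ q ∂μ ≤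
      C₂ * ENNReal.ofReal (1 / s) := by
    calc ∫⁻ x, ENNReal.ofReal (1 / q) * (M⁻¹ * T x) ^ q ∂μ
        ≤ ∫⁻ x, (∫⁻ t in Set.Ioi (0 : ℝ), ENNReal.ofReal (t ^ (q - 2)) *
            ∫⁻ y, G t y * k t (x - y) ∂μ) ∂μ := lintegral_mono hpt
      _ = ∫⁻ t in Set.Ioi (0 : ℝ), ∫⁻ x, ENNReal.ofReal (t ^ (q - 2)) *
            ∫⁻ y, G t y * k t (x - y) ∂μ ∂μ := by
          refine lintegral_lintegral_swap (Measurable.aemeasurable ?_)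
          exact Measurable.mul (by fun_prop) (hH.comp measurable_swap)
      _ = ∫⁻ t in Set.Ioi (0 : ℝ), ENNReal.ofReal (t ^ (q - 2)) *
            ∫⁻ y, ∫⁻ x, G t y * k t (x - y) ∂μ ∂μ := by
          refine lintegral_congr fun t => ?_
          rw [lintegral_const_mul' _ _ ENNReal.ofReal_ne_top]
          congr 1
          refine lintegral_lintegral_swap (Measurable.aemeasurable ?_)
          exact hGk.comp (f := fun z : E × E => ((t, z.1), z.2)) (by fun_prop)
      _ ≤ ∫⁻ t in Set.Ioi (0 : ℝ), ∫⁻ y, C₂ * (ENNReal.ofReal (t ^ (s - 1)) * G t y) ∂μ := by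
          refine setLIntegral_mono' measurableSet_Ioi fun t (ht : 0 < t) => ?_
          have hGt : Measurable (G t) := hG.comp measurable_prodMk_left
          have hkt : Measurable (k t) := hk.comp measurable_prodMk_left
          rw [← lintegral_const_mul' _ _ ENNReal.ofReal_ne_top]
          refine lintegral_mono fun y => ?_
          rw [lintegral_const_mul _ (by fun_prop)]
          calc ENNReal.ofReal (t ^ (q - 2)) * (G t y * ∫⁻ x, k t (x - y) ∂μ)
              ≤ ENNReal.ofReal (t ^ (q - 2)) *
                (G t y * (C₂ * ENNReal.ofReal (t ^ (-q / d * β)))) := by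
                gcongr
                exact hk_int t ht y
            _ = C₂ * (ENNReal.ofReal (t ^ (q - 2)) * ENNReal.ofReal (t ^ (-q / d * β)) *
                G t y) := by ring
            _ = _ := by
                rw [ofReal_rpow_mul_ofReal_rpow ht]
                congr 4
                rw [hs_def, hβ]
                field_simp
                ring
      _ = ∫⁻ y, (∫⁻ t in Set.Ioi (0 : ℝ), C₂ * (ENNReal.ofReal (t ^ (s - 1)) * G t y)) ∂μ := by
          refine lintegral_lintegral_swap (Measurable.aemeasurable ?_)
          exact Measurable.const_mul (Measurable.mul (by fun_prop) hG) _
      _ = ∫⁻ y, C₂ * ENNReal.ofReal (1 / s) * g y ^ p ∂μ := by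
          refine lintegral_congr fun y => ?_
          have hin : ∀ t : ℝ, C₂ * (ENNReal.ofReal (t ^ (s - 1)) * G t y) = C₂ * g y *
              (if ENNReal.ofReal t < g y ^ (p / q) then ENNReal.ofReal (t ^ (s - 1)) else 0) := by
            intro t
            simp only [hG_def]
            split_ifs <;> ring
          simp_rw [hin]
          rw [lintegral_const_mul _ (Measurable.ite (measurableSet_lt (by fun_prop) (by fun_prop))
            (by fun_prop) measurable_const), setLIntegral_Ioi_ite_rpow hs, ← ENNReal.rpow_mul]
          have hexp : p / q * s = p - 1 := by
            rw [hs_def]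
            field_simp
          have hgp : g y ^ p = g y * g y ^ (p - 1) := by
            conv_rhs => enter [1]; rw [← ENNReal.rpow_one (g y)]
            rw [← ENNReal.rpow_add_of_nonneg _ _ zero_le_one (by linarith), add_sub_cancel]
          rw [hexp, hgp]
          ring
      _ = _ := by
          rw [lintegral_const_mul _ (by fun_prop), hg1, mul_one]
  have hTx : ∀ x, T x ^ q =
      M ^ q * (ENNReal.ofReal q * (ENNReal.ofReal (1 / q) * (M⁻¹ * T x) ^ q)) := by
    intro x
    rw [← mul_assoc (ENNReal.ofReal q), ← ENNReal.ofReal_mul hq0.le, mul_one_div_cancel hq0.ne',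
      ENNReal.ofReal_one, one_mul, ← ENNReal.mul_rpow_of_nonneg _ _ hq0.le,
      ENNReal.mul_inv_cancel_left hM0 hMtop]
  calc ∫⁻ x, T x ^ q ∂μ
      = M ^ q * (ENNReal.ofReal q * ∫⁻ x, ENNReal.ofReal (1 / q) * (M⁻¹ * T x) ^ q ∂μ) := by
        simp_rw [hTx]
        rw [lintegral_const_mul' _ _ (by finiteness), lintegral_const_mul' _ _ (by finiteness)]
    _ ≤ _ := by gcongr

/-- **Hardy–Littlewood–Sobolev inequality**. -/
theorem exists_lintegral_fractionalIntegral_rpow_le {p q β : ℝ} (hp : 1 < p) (hpq : p < q)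
    (hβ : β = finrank ℝ E * (1 / p - 1 / q)) :
    ∃ C : ℝ≥0∞, C ≠ ⊤ ∧ ∀ g : E → ℝ≥0∞, Measurable g →
      (∫⁻ x, (∫⁻ y, g y * ENNReal.ofReal (‖x - y‖ ^ (β - finrank ℝ E)) ∂μ) ^ q ∂μ) ^ (1 / q) ≤
        C * (∫⁻ y, g y ^ p ∂μ) ^ (1 / p) := by
  obtain ⟨C, hC, h⟩ := exists_lintegral_fractionalIntegral_rpow_le_of_lintegral_eq_one μ hp hpq hβ
  have hp0 : 0 < p := by linarith
  have hq0 : 0 < q := by linarith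
  refine ⟨C ^ (1 / q) + 1, by finiteness, fun g hg => ?_⟩
  set I : ℝ≥0∞ := (∫⁻ y, g y ^ p ∂μ) ^ (1 / p) with hI_def
  have hIp : ∫⁻ y, g y ^ p ∂μ = I ^ p := by
    rw [hI_def, ← ENNReal.rpow_mul, one_div_mul_cancel hp0.ne', ENNReal.rpow_one]
  rcases eq_or_ne I 0 with h0 | h0
  · rw [h0, ENNReal.zero_rpow_of_pos hp0, lintegral_eq_zero_iff (by fun_prop)] at hIp
    have hz : ∀ x, ∫⁻ y, g y * ENNReal.ofReal (‖x - y‖ ^ (β - finrank ℝ E)) ∂μ = 0 := by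
      intro x
      refine lintegral_eq_zero_of_ae_eq_zero ?_
      filter_upwards [hIp] with y hy
      have : g y = 0 := by simpa [hp0, hp0.not_gt] using hy
      simp [this]
    simp [hz, hq0]
  rcases eq_or_ne I ⊤ with hT | hT
  · simp [hT]
  have h1 : ∫⁻ y, (I⁻¹ * g y) ^ p ∂μ = 1 := by
    simp_rw [ENNReal.mul_rpow_of_nonneg _ _ hp0.le]
    rw [lintegral_const_mul _ (by fun_prop), hIp, ← ENNReal.mul_rpow_of_nonneg _ _ hp0.le,
      ENNReal.inv_mul_cancel h0 hT, ENNReal.one_rpow]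
  have h2 := h (fun y => I⁻¹ * g y) (by fun_prop) h1
  have hI' : I⁻¹ ≠ ⊤ := ENNReal.inv_ne_top.2 h0
  simp_rw [mul_assoc, lintegral_const_mul' _ _ hI', ENNReal.mul_rpow_of_nonneg _ _ hq0.le] at h2
  rw [lintegral_const_mul' _ _ (by finiteness)] at h2
  have h3 := ENNReal.rpow_le_rpow h2 (show 0 ≤ 1 / q by positivity)
  rw [ENNReal.mul_rpow_of_nonneg _ _ (by positivity), ← ENNReal.rpow_mul,
    mul_one_div_cancel hq0.ne', ENNReal.rpow_one, ENNReal.inv_mul_le_iff h0 hT] at h3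
  refine h3.trans ?_
  rw [mul_comm]
  gcongr
  exact le_self_add

end HardyLittlewoodSobolev

section StrongType

variable {E : Type*} [MeasurableSpace E] {μ : Measure E} {p q : ℝ}

/-- The integral operator with kernel `K` is bounded from `L^p` to `L^q`. -/
def IsStrongTypeKernel (μ : Measure E) (p q : ℝ) (K : E → E → ℝ≥0∞) : Prop :=
  ∃ C : ℝ≥0∞, C ≠ ⊤ ∧ ∀ g : E → ℝ≥0∞, Measurable g →
    (∫⁻ x, (∫⁻ y, K x y * g y ∂μ) ^ q ∂μ) ^ (1 / q) ≤ C * (∫⁻ y, g y ^ p ∂μ) ^ (1 / p)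

theorem IsStrongTypeKernel.mono_const_mul (hq : 0 < q) {K K' : E → E → ℝ≥0∞}
    (h : IsStrongTypeKernel μ p q K') {c : ℝ≥0∞} (hc : c ≠ ⊤)
    (hle : ∀ᵐ x ∂μ, ∀ᵐ y ∂μ, K x y ≤ c * K' x y) : IsStrongTypeKernel μ p q K := by
  obtain ⟨C, hC, hK'⟩ := h
  refine ⟨c * C, by finiteness, fun g hg => ?_⟩
  calc (∫⁻ x, (∫⁻ y, K x y * g y ∂μ) ^ q ∂μ) ^ (1 / q)
      ≤ (∫⁻ x, (c * ∫⁻ y, K' x y * g y ∂μ) ^ q ∂μ) ^ (1 / q) := by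
        refine ENNReal.rpow_le_rpow (lintegral_mono_ae ?_) (by positivity)
        filter_upwards [hle] with x hx
        refine ENNReal.rpow_le_rpow ?_ hq.le
        rw [← lintegral_const_mul' _ _ hc]
        refine lintegral_mono_ae ?_
        filter_upwards [hx] with y hy
        rw [← mul_assoc]
        gcongr
    _ = c * (∫⁻ x, (∫⁻ y, K' x y * g y ∂μ) ^ q ∂μ) ^ (1 / q) := by
        simp_rw [ENNReal.mul_rpow_of_nonneg _ _ hq.le]
        rw [lintegral_const_mul' _ _ (by finiteness),
          ENNReal.mul_rpow_of_nonneg _ _ (by positivity), ← ENNReal.rpow_mul,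
          mul_one_div_cancel hq.ne', ENNReal.rpow_one]
    _ ≤ _ := by
        rw [mul_assoc]
        gcongr
        exact hK' g hg

theorem IsStrongTypeKernel.add [SFinite μ] (hq : 1 ≤ q) {K K' : E → E → ℝ≥0∞}
    (hKm : Measurable (Function.uncurry K)) (hKm' : Measurable (Function.uncurry K'))
    (h : IsStrongTypeKernel μ p q K) (h' : IsStrongTypeKernel μ p q K') :
    IsStrongTypeKernel μ p q (fun x y => K x y + K' x y) := by
  obtain ⟨C, hC, hK⟩ := h
  obtain ⟨C', hC', hK'⟩ := h'
  refine ⟨C + C', by finiteness, fun g hg => ?_⟩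
  have hm : Measurable fun z : E × E => K z.1 z.2 * g z.2 := hKm.mul (hg.comp measurable_snd)
  have hm' : Measurable fun z : E × E => K' z.1 z.2 * g z.2 := hKm'.mul (hg.comp measurable_snd)
  calc (∫⁻ x, (∫⁻ y, (K x y + K' x y) * g y ∂μ) ^ q ∂μ) ^ (1 / q)
      = (∫⁻ x, (((fun x => ∫⁻ y, K x y * g y ∂μ) + fun x => ∫⁻ y, K' x y * g y ∂μ) x) ^ q
          ∂μ) ^ (1 / q) := by
        congr 1
        refine lintegral_congr fun x => ?_
        simp_rw [Pi.add_apply, add_mul]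
        congr 1
        exact lintegral_add_left (hm.comp measurable_prodMk_left) _
    _ ≤ _ := (ENNReal.lintegral_Lp_add_le hm.lintegral_prod_right'.aemeasurable
        hm'.lintegral_prod_right'.aemeasurable hq).trans
          (by rw [add_mul]; exact add_le_add (hK g hg) (hK' g hg))

end StrongType

section PowerKernels

open Module

variable {E : Type*} [NormedAddCommGroup E] [NormedSpace ℝ E] [FiniteDimensional ℝ E]
  [Nontrivial E] [MeasurableSpace E] [BorelSpace E] (μ : Measure E) [μ.IsAddHaarMeasure]

theorem ae_ne_of_isAddHaarMeasure (x : E) : ∀ᵐ y ∂μ, y ≠ x :=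
  compl_mem_ae_iff.2 (measure_singleton x)

/-- Schur test, with power weights, for a product of powers restricted to a region. -/
theorem isStrongTypeKernel_of_region {p q a b t : ℝ} (hp : 1 < p) (hpq : p ≤ q)
    (hab : a + b + finrank ℝ E = finrank ℝ E * (1 / p - 1 / q))
    {P : E → E → Prop} [DecidableRel P] (hP : MeasurableSet {z : E × E | P z.1 z.2})
    {C₁ C₂ : ℝ≥0∞} (hC₁ : C₁ ≠ ⊤) (hC₂ : C₂ ≠ ⊤)
    (h₁ : ∀ x : E, 0 < ‖x‖ →
      ∫⁻ y, (if P x y then ENNReal.ofReal (‖y‖ ^ (-t * (p / (p - 1)))) else 0) ∂μ ≤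
        C₁ * ENNReal.ofReal (‖x‖ ^ (finrank ℝ E + -t * (p / (p - 1)))))
    (h₂ : ∀ y : E, 0 < ‖y‖ →
      ∫⁻ x, (if P x y then ENNReal.ofReal (‖x‖ ^ (-(b + t) * q - finrank ℝ E)) else 0) ∂μ ≤
        C₂ * ENNReal.ofReal (‖y‖ ^ (finrank ℝ E + (-(b + t) * q - finrank ℝ E)))) :
    IsStrongTypeKernel μ p q fun x y =>
      if P x y then ENNReal.ofReal (‖x‖ ^ a) * ENNReal.ofReal (‖y‖ ^ b) else 0 := by
  set d : ℝ := (finrank ℝ E : ℝ) with hd_def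
  have hp0 : 0 < p := by linarith
  have hq0 : 0 < q := by linarith
  have hpc : p.HolderConjugate (p / (p - 1)) := Real.HolderConjugate.conjExponent hp
  set p' := p / (p - 1) with hp'_def
  have hp'0 : 0 < p' := hpc.symm.pos
  have hinv : 1 / p' = 1 - 1 / p := by
    have := hpc.inv_add_inv_eq_one
    simp only [one_div]
    linarith
  set K₁ : E → E → ℝ≥0∞ := fun x y => if P x y then ENNReal.ofReal (‖y‖ ^ (-t)) else 0
  set K₂ : E → E → ℝ≥0∞ := fun x y =>
    if P x y then ENNReal.ofReal (‖x‖ ^ a) * ENNReal.ofReal (‖y‖ ^ (b + t)) else 0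
  set A : E → ℝ≥0∞ := fun x => C₁ ^ (1 / p') * ENNReal.ofReal (‖x‖ ^ (d / p' - t))
  have hK₁ : Measurable (Function.uncurry K₁) :=
    Measurable.ite hP (by fun_prop) measurable_const
  have hK₂ : Measurable (Function.uncurry K₂) :=
    Measurable.ite hP (by fun_prop) measurable_const
  have hA : Measurable A := by fun_prop
  have hrow : ∀ᵐ x ∂μ, (∫⁻ y, K₁ x y ^ p' ∂μ) ^ (1 / p') ≤ A x := by
    filter_upwards [ae_ne_of_isAddHaarMeasure μ 0] with x hx
    have hx' : 0 < ‖x‖ := norm_pos_iff.2 hx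
    have : ∫⁻ y, K₁ x y ^ p' ∂μ ≤ C₁ * ENNReal.ofReal (‖x‖ ^ (d + -t * p')) := by
      refine le_trans (lintegral_mono_ae ?_) (h₁ x hx')
      filter_upwards [ae_ne_of_isAddHaarMeasure μ 0] with y hy
      simp only [K₁]
      split_ifs
      · exact (ofReal_rpow_rpow (norm_pos_iff.2 hy) _ _).le
      · exact (ENNReal.zero_rpow_of_pos hp'0).le
    refine (ENNReal.rpow_le_rpow this (by positivity)).trans_eq ?_
    rw [ENNReal.mul_rpow_of_nonneg _ _ (by positivity), ofReal_rpow_rpow hx']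
    simp only [A]
    congr 3
    field_simp
    ring
  have hcol : ∀ᵐ y ∂μ, ∫⁻ x, (A x * K₂ x y) ^ q ∂μ ≤ C₁ ^ (1 / p' * q) * C₂ := by
    filter_upwards [ae_ne_of_isAddHaarMeasure μ 0] with y hy
    have hy' : 0 < ‖y‖ := norm_pos_iff.2 hy
    have hle : ∀ᵐ x ∂μ, (A x * K₂ x y) ^ q ≤
        C₁ ^ (1 / p' * q) * ENNReal.ofReal (‖y‖ ^ ((b + t) * q)) *
          (if P x y then ENNReal.ofReal (‖x‖ ^ (-(b + t) * q - d)) else 0) := by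
      filter_upwards [ae_ne_of_isAddHaarMeasure μ 0] with x hx
      have hx' : 0 < ‖x‖ := norm_pos_iff.2 hx
      simp only [A, K₂]
      split_ifs
      · have hexp : (d / p' - t + a) * q = -(b + t) * q - d := by
          have : a = d * (1 / p - 1 / q) - b - d := by linarith
          rw [div_eq_mul_one_div d p', hinv, this]
          field_simp
          ring
        rw [mul_assoc, ← mul_assoc (ENNReal.ofReal (‖x‖ ^ (d / p' - t))),
          ofReal_rpow_mul_ofReal_rpow hx', ENNReal.mul_rpow_of_nonneg _ _ hq0.le,
          ENNReal.mul_rpow_of_nonneg _ _ hq0.le, ofReal_rpow_rpow hx', ofReal_rpow_rpow hy',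
          ← ENNReal.rpow_mul, hexp, mul_assoc, mul_comm (ENNReal.ofReal (‖y‖ ^ ((b + t) * q)))]
      · simp [hq0]
    refine (lintegral_mono_ae hle).trans ?_
    rw [lintegral_const_mul' _ _ (by finiteness)]
    refine (mul_le_mul' le_rfl (h₂ y hy')).trans_eq ?_
    rw [mul_mul_mul_comm, ofReal_rpow_mul_ofReal_rpow hy']
    have : (b + t) * q + (d + (-(b + t) * q - d)) = 0 := by ring
    rw [this, Real.rpow_zero, ENNReal.ofReal_one, mul_one]
  refine ⟨(C₁ ^ (1 / p' * q) * C₂) ^ (1 / q), by finiteness, fun g hg => ?_⟩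
  refine le_trans (le_of_eq ?_)
    (lintegral_kernel_rpow_le_of_schur hpc hpq hK₁ hK₂ hA hrow hcol hg)
  congr 1
  refine lintegral_congr fun x => ?_
  congr 1
  refine lintegral_congr_ae ?_
  filter_upwards [ae_ne_of_isAddHaarMeasure μ 0] with y hy
  simp only [K₁, K₂]
  split_ifs
  · rw [mul_left_comm, ofReal_rpow_mul_ofReal_rpow (norm_pos_iff.2 hy)]
    congr 4
    ring
  · simp

/-- Hardy-type inequality for the kernel `‖x‖ ^ a * ‖y‖ ^ b` on `‖y‖ < ‖x‖`. -/
theorem isStrongTypeKernel_norm_lt {p q a b : ℝ} (hp : 1 < p) (hpq : p ≤ q)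
    (hab : a + b + finrank ℝ E = finrank ℝ E * (1 / p - 1 / q))
    (hb : -b < finrank ℝ E * (p - 1) / p) :
    IsStrongTypeKernel μ p q fun x y =>
      if ‖y‖ < ‖x‖ then ENNReal.ofReal (‖x‖ ^ a) * ENNReal.ofReal (‖y‖ ^ b) else 0 := by
  have hp1 : 0 < p - 1 := by linarith
  have hq0 : 0 < q := by linarith
  obtain ⟨t, hbt, htd⟩ := exists_between hb
  have ht : 0 < finrank ℝ E + -t * (p / (p - 1)) := by
    rw [lt_div_iff₀ (by linarith)] at htd
    rw [← sub_pos] at htd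
    have : finrank ℝ E + -t * (p / (p - 1)) = (finrank ℝ E * (p - 1) - t * p) / (p - 1) := by
      field_simp
      ring
    rw [this]
    positivity
  obtain ⟨C₁, hC₁, h₁⟩ := exists_lintegral_norm_lt_rpow_le μ ht
  obtain ⟨C₂, hC₂, h₂⟩ := exists_lintegral_le_norm_rpow_le μ
    (a := -(b + t) * q - finrank ℝ E) (by nlinarith)
  refine isStrongTypeKernel_of_region μ (P := fun x y => ‖y‖ < ‖x‖) hp hpq hab
    (measurableSet_lt (by fun_prop) (by fun_prop)) hC₁ hC₂ (fun x hx => h₁ _ hx) fun y hy => ?_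
  refine (lintegral_mono fun x => ?_).trans (h₂ _ hy)
  dsimp only
  split_ifs with h h'
  exacts [le_rfl, absurd h.le h', zero_le, le_rfl]

/-- Hardy-type inequality for the kernel `‖x‖ ^ a * ‖y‖ ^ b` on `‖x‖ < ‖y‖`. -/
theorem isStrongTypeKernel_lt_norm {p q a b : ℝ} (hp : 1 < p) (hpq : p ≤ q)
    (hab : a + b + finrank ℝ E = finrank ℝ E * (1 / p - 1 / q))
    (hb : finrank ℝ E * (p - 1) / p < -b) :
    IsStrongTypeKernel μ p q fun x y =>
      if ‖x‖ < ‖y‖ then ENNReal.ofReal (‖x‖ ^ a) * ENNReal.ofReal (‖y‖ ^ b) else 0 := by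
  have hp1 : 0 < p - 1 := by linarith
  have hq0 : 0 < q := by linarith
  obtain ⟨t, htd, hbt⟩ := exists_between hb
  have ht : finrank ℝ E + -t * (p / (p - 1)) < 0 := by
    rw [div_lt_iff₀ (by linarith)] at htd
    rw [← sub_neg] at htd
    have : finrank ℝ E + -t * (p / (p - 1)) = (finrank ℝ E * (p - 1) - t * p) / (p - 1) := by
      field_simp
      ring
    rw [this]
    exact div_neg_of_neg_of_pos htd hp1
  obtain ⟨C₁, hC₁, h₁⟩ := exists_lintegral_le_norm_rpow_le μ ht
  obtain ⟨C₂, hC₂, h₂⟩ := exists_lintegral_norm_lt_rpow_le μ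
    (a := -(b + t) * q - finrank ℝ E) (by nlinarith)
  refine isStrongTypeKernel_of_region μ (P := fun x y => ‖x‖ < ‖y‖) hp hpq hab
    (measurableSet_lt (by fun_prop) (by fun_prop)) hC₁ hC₂ (fun x hx => ?_) fun y hy => h₂ _ hy
  refine (lintegral_mono fun y => ?_).trans (h₁ _ hx)
  dsimp only
  split_ifs with h h'
  exacts [le_rfl, absurd h.le h', zero_le, le_rfl]

/-- Schur test for the truncated diagonal kernel `‖x‖ ^ (-α) * ‖x - y‖ ^ (α - d)`. -/
theorem isStrongTypeKernel_diagonal {p α : ℝ} (hp : 1 < p) (hα : 0 < α) :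
    IsStrongTypeKernel μ p p fun x y =>
      ENNReal.ofReal (‖x‖ ^ (-α)) * if ‖x - y‖ < 4 * ‖x‖ ∧ ‖x - y‖ < 4 * ‖y‖ then
        ENNReal.ofReal (‖x - y‖ ^ (α - finrank ℝ E)) else 0 := by
  have hp0 : 0 < p := by linarith
  have hpc : p.HolderConjugate (p / (p - 1)) := Real.HolderConjugate.conjExponent hp
  set p' := p / (p - 1) with hp'_def
  have hp'0 : 0 < p' := hpc.symm.pos
  have hinv : 1 / p' = 1 - 1 / p := by
    have := hpc.inv_add_inv_eq_one
    simp only [one_div]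
    linarith
  obtain ⟨C, hC, h⟩ := exists_lintegral_norm_lt_rpow_le μ (a := α - finrank ℝ E) (by linarith)
  set d : ℝ := (finrank ℝ E : ℝ) with hd_def
  set k : E → E → ℝ≥0∞ := fun x y => if ‖x - y‖ < 4 * ‖x‖ ∧ ‖x - y‖ < 4 * ‖y‖ then
        ENNReal.ofReal (‖x - y‖ ^ (α - d)) else 0 with hk_def
  have hkS : MeasurableSet {z : E × E | ‖z.1 - z.2‖ < 4 * ‖z.1‖ ∧ ‖z.1 - z.2‖ < 4 * ‖z.2‖} :=
    (measurableSet_lt (f := fun z : E × E => ‖z.1 - z.2‖) (g := fun z => 4 * ‖z.1‖)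
      (by fun_prop) (by fun_prop)).inter
    (measurableSet_lt (f := fun z : E × E => ‖z.1 - z.2‖) (g := fun z => 4 * ‖z.2‖)
      (by fun_prop) (by fun_prop))
  have hk : Measurable (Function.uncurry k) :=
    Measurable.ite hkS (by fun_prop) measurable_const
  set D : ℝ≥0∞ := C * ENNReal.ofReal (4 ^ α) with hD_def
  have hD : D ≠ ⊤ := by finiteness
  have hC4 : ∀ r : ℝ, 0 < r → C * ENNReal.ofReal ((4 * r) ^ (d + (α - d))) =
      D * ENNReal.ofReal (r ^ α) := by
    intro r hr
    rw [add_sub_cancel, Real.mul_rpow (by norm_num) hr.le, ENNReal.ofReal_mul (by positivity),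
      mul_assoc]
  have hrow : ∀ x : E, 0 < ‖x‖ → ∫⁻ y, k x y ∂μ ≤ D * ENNReal.ofReal (‖x‖ ^ α) := by
    intro x hx
    rw [← hC4 _ hx]
    refine le_trans ?_ (h (4 * ‖x‖) (by positivity))
    rw [← lintegral_sub_left_eq_self (μ := μ)
        (fun z : E => if ‖z‖ < 4 * ‖x‖ then ENNReal.ofReal (‖z‖ ^ (α - d)) else 0) x]
    refine lintegral_mono fun y => ?_
    simp only [hk_def]
    split_ifs <;> simp_all
  have hcol : ∀ y : E, 0 < ‖y‖ → ∫⁻ x, k x y ∂μ ≤ D * ENNReal.ofReal (‖y‖ ^ α) := by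
    intro y hy
    rw [← hC4 _ hy]
    refine le_trans ?_ (h (4 * ‖y‖) (by positivity))
    rw [← lintegral_sub_right_eq_self (μ := μ)
        (fun z : E => if ‖z‖ < 4 * ‖y‖ then ENNReal.ofReal (‖z‖ ^ (α - d)) else 0) y]
    refine lintegral_mono fun x => ?_
    simp only [hk_def]
    split_ifs <;> simp_all
  set A : E → ℝ≥0∞ := fun x => D ^ (1 / p') * ENNReal.ofReal (‖x‖ ^ (α * (1 / p')))
  have hA : Measurable A := by fun_prop
  have h₁ : ∀ᵐ x ∂μ, (∫⁻ y, (k x y ^ (1 / p')) ^ p' ∂μ) ^ (1 / p') ≤ A x := by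
    filter_upwards [ae_ne_of_isAddHaarMeasure μ 0] with x hx
    have hx' : 0 < ‖x‖ := norm_pos_iff.2 hx
    simp_rw [← ENNReal.rpow_mul, one_div_mul_cancel hp'0.ne', ENNReal.rpow_one]
    refine (ENNReal.rpow_le_rpow (hrow x hx') (by positivity)).trans_eq ?_
    rw [ENNReal.mul_rpow_of_nonneg _ _ (by positivity), ofReal_rpow_rpow hx']
  have h₂ : ∀ᵐ y ∂μ, ∫⁻ x, (A x * (ENNReal.ofReal (‖x‖ ^ (-α)) * k x y ^ (1 / p))) ^ p ∂μ ≤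
      D ^ (1 / p' * p) * ENNReal.ofReal (5 ^ |-α|) * D := by
    filter_upwards [ae_ne_of_isAddHaarMeasure μ 0] with y hy
    have hy' : 0 < ‖y‖ := norm_pos_iff.2 hy
    have hle : ∀ᵐ x ∂μ, (A x * (ENNReal.ofReal (‖x‖ ^ (-α)) * k x y ^ (1 / p))) ^ p ≤
        D ^ (1 / p' * p) * ENNReal.ofReal (5 ^ |-α|) * ENNReal.ofReal (‖y‖ ^ (-α)) *
          k x y := by
      filter_upwards [ae_ne_of_isAddHaarMeasure μ 0] with x hx
      have hx' : 0 < ‖x‖ := norm_pos_iff.2 hx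
      have hexp : (α * (1 / p') + -α) * p = -α := by
        rw [hinv]
        field_simp
        ring
      simp only [A]
      rw [mul_assoc, ← mul_assoc (ENNReal.ofReal (‖x‖ ^ (α * (1 / p')))),
        ofReal_rpow_mul_ofReal_rpow hx', ENNReal.mul_rpow_of_nonneg _ _ hp0.le,
        ENNReal.mul_rpow_of_nonneg _ _ hp0.le, ofReal_rpow_rpow hx', ← ENNReal.rpow_mul,
        ← ENNReal.rpow_mul, one_div_mul_cancel hp0.ne', ENNReal.rpow_one, hexp]
      by_cases hr : ‖x - y‖ < 4 * ‖x‖ ∧ ‖x - y‖ < 4 * ‖y‖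
      · have h1 : ‖x‖ ≤ 5 * ‖y‖ := by
          have := norm_le_norm_sub_add x y
          linarith [hr.2]
        have h2 : ‖y‖ ≤ 5 * ‖x‖ := by
          have := norm_le_norm_sub_add y x
          rw [norm_sub_rev] at this
          linarith [hr.1]
        calc D ^ (1 / p' * p) * (ENNReal.ofReal (‖x‖ ^ (-α)) * k x y)
            ≤ D ^ (1 / p' * p) *
              (ENNReal.ofReal (5 ^ |-α|) * ENNReal.ofReal (‖y‖ ^ (-α)) * k x y) := by
              gcongr
              exact ofReal_rpow_le_of_le_mul hy' hx' h1 h2 _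
          _ = _ := by ring
      · simp [hk_def, hr]
    refine (lintegral_mono_ae hle).trans ?_
    rw [lintegral_const_mul' _ _ (by finiteness)]
    refine (mul_le_mul' le_rfl (hcol y hy')).trans_eq ?_
    rw [mul_mul_mul_comm, ofReal_rpow_mul_ofReal_rpow hy', neg_add_cancel, Real.rpow_zero,
      ENNReal.ofReal_one, mul_one]
  refine ⟨(D ^ (1 / p' * p) * ENNReal.ofReal (5 ^ |-α|) * D) ^ (1 / p), by finiteness,
    fun g hg => ?_⟩
  have hkz : Measurable fun z : E × E => k z.1 z.2 := hk
  refine le_trans (le_of_eq ?_) (lintegral_kernel_rpow_le_of_schur hpc le_rfl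
    (K₁ := fun x y => k x y ^ (1 / p'))
    (K₂ := fun x y => ENNReal.ofReal (‖x‖ ^ (-α)) * k x y ^ (1 / p))
    (by simp only [Function.uncurry_def]; fun_prop)
    (by simp only [Function.uncurry_def]; fun_prop) hA h₁ h₂ hg)
  have hsplit : ∀ x y, k x y ^ (1 / p') * (ENNReal.ofReal (‖x‖ ^ (-α)) * k x y ^ (1 / p)) =
      ENNReal.ofReal (‖x‖ ^ (-α)) * k x y := by
    intro x y
    rw [mul_left_comm, ← ENNReal.rpow_add_of_nonneg _ _ (by positivity) (by positivity), hinv,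
      sub_add_cancel, ENNReal.rpow_one]
  simp_rw [hsplit]
  rfl

end PowerKernels

section SteinWeiss

open Module

variable {E : Type*} [NormedAddCommGroup E] [NormedSpace ℝ E] [FiniteDimensional ℝ E]
  [Nontrivial E] [MeasurableSpace E] [BorelSpace E] (μ : Measure E) [μ.IsAddHaarMeasure]

/-- The part of the Stein–Weiss kernel where `x` and `y` have comparable norms. -/
theorem isStrongTypeKernel_steinWeiss_of_comparable {p q α γ δ : ℝ} (hp : 1 < p) (hpq : p ≤ q)
    (hα : 0 < α) (hγδ : 0 ≤ γ + δ)
    (hbal : α - (γ + δ) = finrank ℝ E * (1 / p - 1 / q)) :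
    IsStrongTypeKernel μ p q fun x y => if ‖x‖ ≤ 2 * ‖y‖ ∧ ‖y‖ ≤ 2 * ‖x‖ then
      ENNReal.ofReal (‖x‖ ^ (-γ)) * ENNReal.ofReal (‖x - y‖ ^ (α - finrank ℝ E)) *
        ENNReal.ofReal (‖y‖ ^ (-δ)) else 0 := by
  set d : ℝ := (finrank ℝ E : ℝ) with hd_def
  have hweight : ∀ x y : E, 0 < ‖x‖ → 0 < ‖y‖ → ‖x‖ ≤ 2 * ‖y‖ → ‖y‖ ≤ 2 * ‖x‖ →
      ENNReal.ofReal (‖x‖ ^ (-γ)) * ENNReal.ofReal (‖y‖ ^ (-δ)) ≤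
        ENNReal.ofReal (2 ^ |-δ|) * ENNReal.ofReal (‖x‖ ^ (-(γ + δ))) := by
    intro x y hx hy h1 h2
    rw [neg_add, ← ofReal_rpow_mul_ofReal_rpow hx, mul_left_comm]
    gcongr
    exact ofReal_rpow_le_of_le_mul hx hy h2 h1 _
  rcases hpq.eq_or_lt with rfl | hlt
  · have hαγδ : γ + δ = α := by simpa [sub_eq_zero, eq_comm] using hbal
    refine (isStrongTypeKernel_diagonal μ hp hα).mono_const_mul (c := ENNReal.ofReal (2 ^ |-δ|))
      (by linarith) ENNReal.ofReal_ne_top ?_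
    filter_upwards [ae_ne_of_isAddHaarMeasure μ 0] with x hx
    filter_upwards [ae_ne_of_isAddHaarMeasure μ 0] with y hy
    have hx' : 0 < ‖x‖ := norm_pos_iff.2 hx
    have hy' : 0 < ‖y‖ := norm_pos_iff.2 hy
    have hxy := norm_sub_le x y
    split_ifs with h1 h2 h2
    · have := hweight x y hx' hy' h1.1 h1.2
      rw [hαγδ] at this
      rw [mul_right_comm, ← mul_assoc]
      gcongr
    · exact absurd ⟨by linarith [h1.2], by linarith [h1.1]⟩ h2
    all_goals exact zero_le
  · obtain ⟨C, hC, h⟩ := exists_lintegral_fractionalIntegral_rpow_le μ hp hlt hbal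
    have hHLS : IsStrongTypeKernel μ p q fun x y : E =>
        ENNReal.ofReal (‖x - y‖ ^ (α - (γ + δ) - d)) :=
      ⟨C, hC, fun g hg => by simpa only [mul_comm] using h g hg⟩
    refine hHLS.mono_const_mul
      (c := ENNReal.ofReal (2 ^ |-δ|) * ENNReal.ofReal (3 ^ (γ + δ)))
      (by linarith) (by finiteness) ?_
    filter_upwards [ae_ne_of_isAddHaarMeasure μ 0] with x hx
    filter_upwards [ae_ne_of_isAddHaarMeasure μ 0, ae_ne_of_isAddHaarMeasure μ x] with y hy hyx
    have hx' : 0 < ‖x‖ := norm_pos_iff.2 hx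
    have hy' : 0 < ‖y‖ := norm_pos_iff.2 hy
    have hxy : 0 < ‖x - y‖ := norm_pos_iff.2 (sub_ne_zero.2 hyx.symm)
    split_ifs with h1
    · have h3 : ‖x - y‖ / 3 ≤ ‖x‖ := by
        linarith [norm_sub_le x y, h1.2]
      have h4 : ENNReal.ofReal (‖x‖ ^ (-(γ + δ))) ≤
          ENNReal.ofReal (3 ^ (γ + δ)) * ENNReal.ofReal (‖x - y‖ ^ (-(γ + δ))) := by
        rw [← ENNReal.ofReal_mul (by positivity)]
        refine ENNReal.ofReal_le_ofReal ?_
        refine (Real.rpow_le_rpow_of_nonpos (by positivity) h3 (by linarith)).trans_eq ?_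
        rw [Real.div_rpow hxy.le (by norm_num), Real.rpow_neg (show (0 : ℝ) ≤ 3 by norm_num),
          div_inv_eq_mul, mul_comm]
      calc ENNReal.ofReal (‖x‖ ^ (-γ)) * ENNReal.ofReal (‖x - y‖ ^ (α - d)) *
            ENNReal.ofReal (‖y‖ ^ (-δ))
          = ENNReal.ofReal (‖x‖ ^ (-γ)) * ENNReal.ofReal (‖y‖ ^ (-δ)) *
            ENNReal.ofReal (‖x - y‖ ^ (α - d)) := by ring
        _ ≤ ENNReal.ofReal (2 ^ |-δ|) * (ENNReal.ofReal (3 ^ (γ + δ)) *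
            ENNReal.ofReal (‖x - y‖ ^ (-(γ + δ)))) * ENNReal.ofReal (‖x - y‖ ^ (α - d)) := by
            exact mul_le_mul' ((hweight x y hx' hy' h1.1 h1.2).trans (mul_le_mul' le_rfl h4)) le_rfl
        _ = _ := by
            rw [← mul_assoc, mul_assoc _ (ENNReal.ofReal (‖x - y‖ ^ (-(γ + δ)))),
              ofReal_rpow_mul_ofReal_rpow hxy]
            congr 3
            ring
    · exact zero_le

theorem isStrongTypeKernel_steinWeiss {p q α γ δ : ℝ} (hp : 1 < p) (hpq : p ≤ q)
    (hα : 0 < α) (hγ : γ < finrank ℝ E / q) (hδ : δ < finrank ℝ E * (p - 1) / p)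
    (hγδ : 0 ≤ γ + δ) (hbal : α - (γ + δ) = finrank ℝ E * (1 / p - 1 / q)) :
    IsStrongTypeKernel μ p q fun x y =>
      ENNReal.ofReal (‖x‖ ^ (-γ)) * ENNReal.ofReal (‖x - y‖ ^ (α - finrank ℝ E)) *
        ENNReal.ofReal (‖y‖ ^ (-δ)) := by
  have hcomp := isStrongTypeKernel_steinWeiss_of_comparable μ hp hpq hα hγδ hbal
  have hp0 : 0 < p := by linarith
  have hq0 : 0 < q := by linarith
  have hlt := isStrongTypeKernel_norm_lt μ (a := -γ + (α - finrank ℝ E)) (b := -δ) hp hpq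
    (by linarith) (by linarith)
  have hgt := isStrongTypeKernel_lt_norm μ (a := -γ) (b := α - finrank ℝ E + -δ) hp hpq
    (by linarith) (by
      have h1 : (finrank ℝ E : ℝ) * (p - 1) / p = finrank ℝ E - finrank ℝ E * (1 / p) := by
        field_simp
      have h2 : (finrank ℝ E : ℝ) / q = finrank ℝ E * (1 / q) := by ring
      rw [h1]
      rw [h2] at hγ
      rw [mul_sub] at hbal
      linarith)
  set d : ℝ := (finrank ℝ E : ℝ) with hd_def
  have hm₁ : Measurable (Function.uncurry fun x y : E => if ‖y‖ < ‖x‖ then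
      ENNReal.ofReal (‖x‖ ^ (-γ + (α - d))) * ENNReal.ofReal (‖y‖ ^ (-δ)) else 0) :=
    Measurable.ite (measurableSet_lt (by fun_prop) (by fun_prop)) (by fun_prop) measurable_const
  have hm₂ : Measurable (Function.uncurry fun x y : E => if ‖x‖ < ‖y‖ then
      ENNReal.ofReal (‖x‖ ^ (-γ)) * ENNReal.ofReal (‖y‖ ^ (α - d + -δ)) else 0) :=
    Measurable.ite (measurableSet_lt (by fun_prop) (by fun_prop)) (by fun_prop) measurable_const
  have hS : MeasurableSet {z : E × E | ‖z.1‖ ≤ 2 * ‖z.2‖ ∧ ‖z.2‖ ≤ 2 * ‖z.1‖} :=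
    (measurableSet_le (f := fun z : E × E => ‖z.1‖) (g := fun z => 2 * ‖z.2‖)
      (by fun_prop) (by fun_prop)).inter
    (measurableSet_le (f := fun z : E × E => ‖z.2‖) (g := fun z => 2 * ‖z.1‖)
      (by fun_prop) (by fun_prop))
  have hm₃ : Measurable (Function.uncurry fun x y : E => if ‖x‖ ≤ 2 * ‖y‖ ∧ ‖y‖ ≤ 2 * ‖x‖ then
      ENNReal.ofReal (‖x‖ ^ (-γ)) * ENNReal.ofReal (‖x - y‖ ^ (α - d)) *
        ENNReal.ofReal (‖y‖ ^ (-δ)) else 0) :=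
    Measurable.ite hS (by fun_prop) measurable_const
  have hq1 : 1 ≤ q := by linarith
  refine ((hlt.add hq1 hm₁ hm₂ hgt).add hq1 (hm₁.add hm₂) hm₃ hcomp).mono_const_mul
    (c := ENNReal.ofReal (2 ^ |α - d|)) hq0 ENNReal.ofReal_ne_top ?_
  have hc1 : 1 ≤ ENNReal.ofReal (2 ^ |α - d|) := by
    rw [← ENNReal.ofReal_one]
    exact ENNReal.ofReal_le_ofReal (Real.one_le_rpow (by norm_num) (abs_nonneg _))
  filter_upwards [ae_ne_of_isAddHaarMeasure μ 0] with x hx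
  filter_upwards [ae_ne_of_isAddHaarMeasure μ 0, ae_ne_of_isAddHaarMeasure μ x] with y hy hyx
  have hx' : 0 < ‖x‖ := norm_pos_iff.2 hx
  have hy' : 0 < ‖y‖ := norm_pos_iff.2 hy
  have hxy : 0 < ‖x - y‖ := norm_pos_iff.2 (sub_ne_zero.2 hyx.symm)
  have htri₁ := norm_sub_le x y
  have htri₂ := norm_le_norm_sub_add x y
  have htri₃ := norm_le_norm_sub_add y x
  rw [norm_sub_rev] at htri₃
  by_cases h1 : ‖x‖ ≤ 2 * ‖y‖
  · by_cases h2 : ‖y‖ ≤ 2 * ‖x‖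
    · rw [if_pos (⟨h1, h2⟩ : ‖x‖ ≤ 2 * ‖y‖ ∧ ‖y‖ ≤ 2 * ‖x‖)]
      exact le_mul_of_one_le_of_le hc1 le_add_self
    · rw [if_pos (show ‖x‖ < ‖y‖ by linarith)]
      refine le_trans ?_ (mul_le_mul' le_rfl (le_self_add.trans' le_add_self))
      rw [← ofReal_rpow_mul_ofReal_rpow hy', mul_left_comm, ← mul_assoc (ENNReal.ofReal (2 ^ _)),
        mul_assoc]
      gcongr
      exact ofReal_rpow_le_of_le_mul hy' hxy (by linarith) (by linarith) _
  · rw [if_pos (show ‖y‖ < ‖x‖ by linarith)]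
    refine le_trans ?_ (mul_le_mul' le_rfl (le_self_add.trans' le_self_add))
    rw [← ofReal_rpow_mul_ofReal_rpow hx', ← mul_assoc, mul_left_comm]
    gcongr
    exact ofReal_rpow_le_of_le_mul hx' hxy (by linarith) (by linarith) _

end SteinWeiss

/-- **Stein–Weiss inequality** (Theorem A). -/
theorem stein_weiss
    (N : ℕ) (hN : 1 ≤ N) (p q α γ δ : ℝ)
    (hp : 1 < p) (hpq : p ≤ q)
    (hα : 0 < α) (hαN : α < (N : ℝ))
    (hγ : γ < (N : ℝ) / q) (hδ : δ < (N : ℝ) * (p - 1) / p)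
    (hγδ : 0 ≤ γ + δ)
    (hbal : α / (N : ℝ) = 1 / p - 1 / q + (γ + δ) / (N : ℝ)) :
    ∃ C : ℝ, 0 < C ∧
      ∀ f : EuclideanSpace ℝ (Fin N) → ℝ≥0∞, Measurable f →
        (∫⁻ x, (ENNReal.ofReal (‖x‖ ^ (-γ)) *
            ∫⁻ y, f y * ENNReal.ofReal (‖x - y‖ ^ (α - (N : ℝ)))) ^ q) ^ (1 / q)
          ≤ ENNReal.ofReal C *
            (∫⁻ x, (f x * ENNReal.ofReal (‖x‖ ^ δ)) ^ p) ^ (1 / p) := by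
  have hN0 : (0 : ℝ) < N := by exact_mod_cast hN
  have hfin : Module.finrank ℝ (EuclideanSpace ℝ (Fin N)) = N := finrank_euclideanSpace_fin
  have : Nontrivial (EuclideanSpace ℝ (Fin N)) :=
    Module.nontrivial_of_finrank_pos (R := ℝ) (by rw [hfin]; exact hN)
  obtain ⟨C, hC, h⟩ := isStrongTypeKernel_steinWeiss
    (volume : Measure (EuclideanSpace ℝ (Fin N))) hp hpq hα (by rwa [hfin]) (by rwa [hfin]) hγδ
    (by
      rw [hfin]
      field_simp at hbal ⊢
      linarith)
  rw [hfin] at h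
  refine ⟨C.toReal + 1, by positivity, fun f hf => ?_⟩
  have hCle : C ≤ ENNReal.ofReal (C.toReal + 1) := by
    rw [ENNReal.le_ofReal_iff_toReal_le hC (by positivity)]
    linarith
  refine le_trans (le_of_eq ?_) ((h (fun y => f y * ENNReal.ofReal (‖y‖ ^ δ))
    (by fun_prop)).trans (mul_le_mul' hCle le_rfl))
  congr 1
  refine lintegral_congr fun x => ?_
  rw [← lintegral_const_mul' _ _ ENNReal.ofReal_ne_top]
  congr 1
  refine lintegral_congr_ae ?_
  filter_upwards [ae_ne_of_isAddHaarMeasure volume 0] with y hy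
  have hyδ : ENNReal.ofReal (‖y‖ ^ (-δ)) * ENNReal.ofReal (‖y‖ ^ δ) = 1 := by
    rw [ofReal_rpow_mul_ofReal_rpow (norm_pos_iff.2 hy), neg_add_cancel, Real.rpow_zero,
      ENNReal.ofReal_one]
  calc _ = ENNReal.ofReal (‖x‖ ^ (-γ)) * ENNReal.ofReal (‖x - y‖ ^ (α - N)) * f y *
        (ENNReal.ofReal (‖y‖ ^ (-δ)) * ENNReal.ofReal (‖y‖ ^ δ)) := by
        rw [hyδ]
        ring
    _ = _ := by ring
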